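/- Let m be real with m ∉ {0, 1/2}. On the open set {z₂ > 0} ⊂ ℝ⁵, the vector field W₇ = z₂^{m−1} ∂_x + ((m−1)/(2m−1)) z₂^{2m−1} ∂_y + (z₁ z₂^{m−1} − y/m) ∂_z + (1 − 1/m) z₂^{m} ∂_{z₁} is an infinitesimal symmetry of the rank-2 distribution of the Monge equation P_m : y' = (z'')^m; that is, at every point p with z₂ > 0, the Lie brackets [W₇, ∂_{z₂}](p) and [W₇, X](p), where X = ∂_x + z₂^{m} ∂_y + z₁ ∂_z + z₂ ∂_{z₁}, lie in the linear span of ∂_{z₂}(p) and X(p). -/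

import Mathlib

open Real

/-- The Lie bracket of vector fields on (an open subset of) `ℝ⁵`:
`[V, W](p) = DW(p)·V(p) - DV(p)·W(p)`. -/
noncomputable def lieB (V W : (Fin 5 → ℝ) → (Fin 5 → ℝ)) (p : Fin 5 → ℝ) : Fin 5 → ℝ :=
  fderiv ℝ W p (V p) - fderiv ℝ V p (W p)

/-- The vertical field `∂_{z₂}` of the rank-2 distribution. -/
noncomputable def Dz2 : (Fin 5 → ℝ) → (Fin 5 → ℝ) := fun _ => ![0, 0, 0, 0, 1]

/-- The total-derivative field `X = ∂_x + z₂^m ∂_y + z₁ ∂_z + z₂ ∂_{z₁}` of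
`P_m : y' = (z'')^m`. -/
noncomputable def XPm (m : ℝ) : (Fin 5 → ℝ) → (Fin 5 → ℝ) :=
  fun p => ![1, p 4 ^ m, p 3, p 4, 0]

/-- `W₇ = z₂^{m-1} ∂_x + ((m-1)/(2m-1)) z₂^{2m-1} ∂_y + (z₁ z₂^{m-1} - y/m) ∂_z
      + (1 - 1/m) z₂^m ∂_{z₁}`. -/
noncomputable def W7 (m : ℝ) : (Fin 5 → ℝ) → (Fin 5 → ℝ) :=
  fun p =>
    ![p 4 ^ (m - 1),
      ((m - 1) / (2 * m - 1)) * p 4 ^ (2 * m - 1),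
      p 3 * p 4 ^ (m - 1) - p 1 / m,
      (1 - 1 / m) * p 4 ^ m,
      0]

/-- The coordinate functions on `ℝ⁵` are their own derivatives. -/
theorem hasFDerivAt_coord (i : Fin 5) (p : Fin 5 → ℝ) :
    HasFDerivAt (fun q : Fin 5 → ℝ => q i)
      (ContinuousLinearMap.proj (R := ℝ) (φ := fun _ : Fin 5 => ℝ) i) p :=
  (ContinuousLinearMap.proj (R := ℝ) (φ := fun _ : Fin 5 => ℝ) i).hasFDerivAt

/-- The directional derivative of a vector field is computed componentwise. -/
theorem fderiv_vec_apply {f₀ f₁ f₂ f₃ f₄ : (Fin 5 → ℝ) → ℝ} {p : Fin 5 → ℝ}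
    {L₀ L₁ L₂ L₃ L₄ : (Fin 5 → ℝ) →L[ℝ] ℝ}
    (h₀ : HasFDerivAt f₀ L₀ p) (h₁ : HasFDerivAt f₁ L₁ p) (h₂ : HasFDerivAt f₂ L₂ p)
    (h₃ : HasFDerivAt f₃ L₃ p) (h₄ : HasFDerivAt f₄ L₄ p) (v : Fin 5 → ℝ) :
    fderiv ℝ (fun q => ![f₀ q, f₁ q, f₂ q, f₃ q, f₄ q]) p v =
      ![L₀ v, L₁ v, L₂ v, L₃ v, L₄ v] := by
  have h : HasFDerivAt (fun q => ![f₀ q, f₁ q, f₂ q, f₃ q, f₄ q])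
      (ContinuousLinearMap.pi ![L₀, L₁, L₂, L₃, L₄]) p := by
    refine hasFDerivAt_pi'.2 fun i => ?_
    fin_cases i <;> assumption
  rw [h.fderiv]
  ext i
  fin_cases i <;> rfl

/-- The directional derivative of the total-derivative field. -/
theorem fderiv_XPm (m : ℝ) {p : Fin 5 → ℝ} (hp : 0 < p 4) (v : Fin 5 → ℝ) :
    fderiv ℝ (XPm m) p v = ![0, m * p 4 ^ (m - 1) * v 4, v 3, v 4, 0] := by
  have hpow := (hasFDerivAt_coord 4 p).rpow_const (p := m) (Or.inl hp.ne')
  refine (fderiv_vec_apply (hasFDerivAt_const 1 p) hpow (hasFDerivAt_coord 3 p)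
    (hasFDerivAt_coord 4 p) (hasFDerivAt_const 0 p) v).trans ?_
  simp

/-- The directional derivative of `W₇`. -/
theorem fderiv_W7 (m : ℝ) {p : Fin 5 → ℝ} (hp : 0 < p 4) (v : Fin 5 → ℝ) :
    fderiv ℝ (W7 m) p v =
      ![(m - 1) * p 4 ^ (m - 1 - 1) * v 4,
        (m - 1) / (2 * m - 1) * ((2 * m - 1) * p 4 ^ (2 * m - 1 - 1) * v 4),
        p 3 * ((m - 1) * p 4 ^ (m - 1 - 1) * v 4) + p 4 ^ (m - 1) * v 3 - v 1 / m,
        (1 - 1 / m) * (m * p 4 ^ (m - 1) * v 4),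
        0] := by
  have hpow (r : ℝ) := (hasFDerivAt_coord 4 p).rpow_const (p := r) (Or.inl hp.ne')
  have hz : HasFDerivAt (fun q : Fin 5 → ℝ => q 3 * q 4 ^ (m - 1) - q 1 / m) _ p :=
    ((hasFDerivAt_coord 3 p).mul (hpow (m - 1))).sub ((hasFDerivAt_coord 1 p).mul_const m⁻¹)
  refine (fderiv_vec_apply (hpow (m - 1)) ((hpow (2 * m - 1)).const_mul ((m - 1) / (2 * m - 1)))
    hz ((hpow m).const_mul (1 - 1 / m)) (hasFDerivAt_const 0 p) v).trans ?_
  simp [div_eq_mul_inv, mul_comm]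

/-- `[W₇, ∂_{z₂}] = -(m - 1) z₂^{m-2} X`. -/
theorem lieB_W7_Dz2 (m : ℝ) (h0 : m ≠ 0) (h12 : m ≠ 1 / 2) {p : Fin 5 → ℝ} (hp : 0 < p 4) :
    lieB (W7 m) Dz2 p = (-((m - 1) * p 4 ^ (m - 2))) • XPm m p := by
  have hm : 2 * m - 1 ≠ 0 := fun h => h12 (by linarith)
  have hD : fderiv ℝ Dz2 p = 0 := (hasFDerivAt_const _ p).fderiv
  have e1 : m - 1 - 1 = m - 2 := by ring
  have e2 : p 4 ^ (2 * m - 1 - 1) = p 4 ^ (m - 2) * p 4 ^ m := by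
    rw [← rpow_add hp]; ring_nf
  have e3 : p 4 ^ (m - 1) = p 4 ^ (m - 2) * p 4 := by
    rw [← rpow_add_one hp.ne']; ring_nf
  have e4 (a : ℝ) : (m - 1) / (2 * m - 1) * ((2 * m - 1) * a) = (m - 1) * a := by
    rw [← mul_assoc, div_mul_cancel₀ _ hm]
  rw [lieB, hD, fderiv_W7 m hp, e1, e2, e3, mul_assoc (2 * m - 1), e4]
  ext i
  fin_cases i <;> simp [Dz2, XPm] <;> field_simp

/-- `[W₇, X] = 0`. -/
theorem lieB_W7_XPm (m : ℝ) {p : Fin 5 → ℝ} (hp : 0 < p 4) :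
    lieB (W7 m) (XPm m) p = 0 := by
  have e : p 4 ^ m = p 4 ^ (m - 1) * p 4 := by
    rw [← rpow_add_one hp.ne']; ring_nf
  rw [lieB, fderiv_XPm m hp, fderiv_W7 m hp]
  ext i
  fin_cases i <;> simp [W7, XPm, e]
  ring

/-- For `m ∉ {0, 1/2}`, the field `W₇` is an infinitesimal symmetry of the
rank-2 distribution `⟨∂_{z₂}, X⟩` of the Monge equation `P_m : y' = (z'')^m` on
`{z₂ > 0}`: both brackets `[W₇, ∂_{z₂}]` and `[W₇, X]` lie pointwise in the span
of `∂_{z₂}` and `X`. -/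
theorem W7_infinitesimal_symmetry (m : ℝ) (h0 : m ≠ 0) (h12 : m ≠ 1 / 2)
    (p : Fin 5 → ℝ) (hp : p 4 > 0) :
    lieB (W7 m) Dz2 p ∈ Submodule.span ℝ ({Dz2 p, XPm m p} : Set (Fin 5 → ℝ)) ∧
    lieB (W7 m) (XPm m) p ∈ Submodule.span ℝ ({Dz2 p, XPm m p} : Set (Fin 5 → ℝ)) := by
  rw [lieB_W7_Dz2 m h0 h12 hp, lieB_W7_XPm m hp]
  exact ⟨Submodule.smul_mem _ _ (Submodule.subset_span (by simp)), Submodule.zero_mem _⟩
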